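/- arXiv:2102.08607 — 9 statements merged into one kernel-verified Lean document; each statement's English description precedes it below -/
import Mathlib

section
/- Suppose that for every (s,a) ∈ 𝒮 × 𝒜 the map θ ↦ ψ(s,a;θ) is differentiable on ℝ^d with ‖∇_θ ψ(s,a;θ)‖ ≤ ℓ_ψ for all θ, where ℓ_ψ ≥ 0. Then for all parameters θ₁, θ₂ ∈ ℝ^d and every state-action pair (s,a), the soft-max policies satisfy π_{θ₂}(a|s) / π_{θ₁}(a|s) ≤ exp(2 ℓ_ψ ‖θ₁ − θ₂‖). -/
open Finset

/-- The soft-max policy `π_θ(a|s) = exp (ψ s a θ) / ∑ a', exp (ψ s a' θ)`. -/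
noncomputable def softmaxPolicy {S A : Type*} [Fintype A] {d : ℕ}
    (ψ : S → A → EuclideanSpace ℝ (Fin d) → ℝ)
    (θ : EuclideanSpace ℝ (Fin d)) (s : S) (a : A) : ℝ :=
  Real.exp (ψ s a θ) / ∑ a', Real.exp (ψ s a' θ)

/-- A function whose gradient has norm at most `C` is `C`-Lipschitz. -/
theorem abs_sub_le_of_hasGradientAt_of_norm_le {E : Type*} [NormedAddCommGroup E]
    [InnerProductSpace ℝ E] [CompleteSpace E] {f : E → ℝ} {f' : E → E} {C : ℝ}
    (hf : ∀ x, HasGradientAt f (f' x) x) (hC : ∀ x, ‖f' x‖ ≤ C) (x y : E) :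
    |f x - f y| ≤ C * ‖x - y‖ := by
  refine convex_univ.norm_image_sub_le_of_norm_hasFDerivWithin_le
    (fun z _ => (hf z).hasFDerivAt.hasFDerivWithinAt) (fun z _ => ?_)
    (Set.mem_univ y) (Set.mem_univ x)
  simpa using hC z

/-- If all the logits at a state move by at most `c`, then each soft-max probability there changes
by a factor of at most `exp (2 * c)`. -/
theorem softmaxPolicy_div_le_of_abs_sub_le {S A : Type*} [Fintype A] {d : ℕ}
    (ψ : S → A → EuclideanSpace ℝ (Fin d) → ℝ) {θ₁ θ₂ : EuclideanSpace ℝ (Fin d)} (s : S) (a : A)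
    {c : ℝ} (h : ∀ b, |ψ s b θ₁ - ψ s b θ₂| ≤ c) :
    softmaxPolicy ψ θ₂ s a / softmaxPolicy ψ θ₁ s a ≤ Real.exp (2 * c) := by
  have hpos : ∀ θ, 0 < ∑ b, Real.exp (ψ s b θ) := fun θ =>
    Finset.sum_pos (fun b _ => Real.exp_pos _) ⟨a, Finset.mem_univ a⟩
  have hnum : Real.exp (ψ s a θ₂) ≤ Real.exp c * Real.exp (ψ s a θ₁) := by
    rw [← Real.exp_add, Real.exp_le_exp]
    linarith [(abs_le.mp (h a)).1]
  have hden : ∑ b, Real.exp (ψ s b θ₁) ≤ Real.exp c * ∑ b, Real.exp (ψ s b θ₂) := by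
    rw [Finset.mul_sum]
    refine Finset.sum_le_sum fun b _ => ?_
    rw [← Real.exp_add, Real.exp_le_exp]
    linarith [(abs_le.mp (h b)).2]
  unfold softmaxPolicy
  rw [div_div_div_eq, div_le_iff₀ (mul_pos (hpos θ₂) (Real.exp_pos _))]
  calc Real.exp (ψ s a θ₂) * ∑ b, Real.exp (ψ s b θ₁)
      ≤ (Real.exp c * Real.exp (ψ s a θ₁)) * (Real.exp c * ∑ b, Real.exp (ψ s b θ₂)) :=
        mul_le_mul hnum hden (hpos θ₁).le (by positivity)
    _ = Real.exp (2 * c) * ((∑ b, Real.exp (ψ s b θ₂)) * Real.exp (ψ s a θ₁)) := by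
        rw [two_mul, Real.exp_add]
        ring

/-- If each `θ ↦ ψ(s,a;θ)` has gradient of norm at most `ℓψ`, then the
soft-max policy ratios are bounded by `exp (2 ℓψ ‖θ₁ - θ₂‖)`. -/
theorem softmaxPolicy_ratio_le {S A : Type*} [Fintype S] [Fintype A] [Nonempty S] [Nonempty A]
    {d : ℕ} (ψ : S → A → EuclideanSpace ℝ (Fin d) → ℝ)
    (ψ' : S → A → EuclideanSpace ℝ (Fin d) → EuclideanSpace ℝ (Fin d))
    (ℓψ : ℝ) (hℓ : 0 ≤ ℓψ)
    (hdiff : ∀ s a θ, HasGradientAt (ψ s a) (ψ' s a θ) θ)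
    (hbound : ∀ s a θ, ‖ψ' s a θ‖ ≤ ℓψ)
    (θ₁ θ₂ : EuclideanSpace ℝ (Fin d)) (s : S) (a : A) :
    softmaxPolicy ψ θ₂ s a / softmaxPolicy ψ θ₁ s a ≤ Real.exp (2 * ℓψ * ‖θ₁ - θ₂‖) := by
  have hlip : ∀ b, |ψ s b θ₁ - ψ s b θ₂| ≤ ℓψ * ‖θ₁ - θ₂‖ := fun b =>
    abs_sub_le_of_hasGradientAt_of_norm_le (hdiff s b) (hbound s b) θ₁ θ₂
  calc softmaxPolicy ψ θ₂ s a / softmaxPolicy ψ θ₁ s a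
      ≤ Real.exp (2 * (ℓψ * ‖θ₁ - θ₂‖)) := softmaxPolicy_div_le_of_abs_sub_le ψ s a hlip
    _ = Real.exp (2 * ℓψ * ‖θ₁ - θ₂‖) := by rw [mul_assoc]
end

section
/- Suppose that for every (s,a) ∈ 𝒮 × 𝒜 the map θ ↦ ψ(s,a;θ) is differentiable on ℝ^d with ‖∇_θ ψ(s,a;θ)‖ ≤ ℓ_ψ for all θ, where ℓ_ψ ≥ 0. Let τ = (s_0,a_0,…,s_{H−1},a_{H−1}) be any length-H trajectory and let θ₁, θ₂ ∈ ℝ^d. Then for every t with 0 ≤ t ≤ H−1, the importance sampling weight satisfies ω_t(τ|π_{θ₁},π_{θ₂}) = ∏_{h=0}^{t} π_{θ₂}(a_h|s_h)/π_{θ₁}(a_h|s_h) ≤ exp(2(t+1) ℓ_ψ ‖θ₁ − θ₂‖). -/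
open Finset

theorem abs_sub_le_of_hasGradientAt_norm_le {E : Type*} [NormedAddCommGroup E]
    [InnerProductSpace ℝ E] [CompleteSpace E] {f : E → ℝ} {f' : E → E} {C : ℝ}
    (hf : ∀ x, HasGradientAt f (f' x) x) (hC : ∀ x, ‖f' x‖ ≤ C) (x y : E) :
    |f y - f x| ≤ C * ‖y - x‖ := by
  rw [← Real.norm_eq_abs]
  refine convex_univ.norm_image_sub_le_of_norm_hasFDerivWithin_le
    (fun z _ => (hf z).hasFDerivAt.hasFDerivWithinAt) (fun z _ => ?_)
    (Set.mem_univ x) (Set.mem_univ y)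
  simpa using hC z

theorem softmaxPolicy_pos {S A : Type*} [Fintype A] {d : ℕ}
    (ψ : S → A → EuclideanSpace ℝ (Fin d) → ℝ)
    (θ : EuclideanSpace ℝ (Fin d)) (s : S) (a : A) : 0 < softmaxPolicy ψ θ s a :=
  div_pos (Real.exp_pos _) (Finset.sum_pos (fun _ _ => Real.exp_pos _) ⟨a, Finset.mem_univ a⟩)

theorem softmaxPolicy_div_le {S A : Type*} [Fintype A] {d : ℕ}
    {ψ : S → A → EuclideanSpace ℝ (Fin d) → ℝ} {θ₁ θ₂ : EuclideanSpace ℝ (Fin d)} {s : S}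
    {c : ℝ} (hc : ∀ a, |ψ s a θ₁ - ψ s a θ₂| ≤ c) (a : A) :
    softmaxPolicy ψ θ₂ s a / softmaxPolicy ψ θ₁ s a ≤ Real.exp (2 * c) := by
  have hZ : ∀ θ, 0 < ∑ a', Real.exp (ψ s a' θ) := fun θ =>
    Finset.sum_pos (fun _ _ => Real.exp_pos _) ⟨a, Finset.mem_univ a⟩
  have hnum : Real.exp (ψ s a θ₂) ≤ Real.exp c * Real.exp (ψ s a θ₁) := by
    rw [← Real.exp_add, Real.exp_le_exp]
    linarith [(abs_le.mp (hc a)).1]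
  have hsum : ∑ a', Real.exp (ψ s a' θ₁) ≤ Real.exp c * ∑ a', Real.exp (ψ s a' θ₂) := by
    rw [Finset.mul_sum]
    refine Finset.sum_le_sum fun a' _ => ?_
    rw [← Real.exp_add, Real.exp_le_exp]
    linarith [(abs_le.mp (hc a')).2]
  rw [div_le_iff₀ (softmaxPolicy_pos ψ θ₁ s a)]
  unfold softmaxPolicy
  rw [← mul_div_assoc, div_le_div_iff₀ (hZ θ₂) (hZ θ₁), two_mul, Real.exp_add]
  calc Real.exp (ψ s a θ₂) * ∑ a', Real.exp (ψ s a' θ₁)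
      ≤ (Real.exp c * Real.exp (ψ s a θ₁)) * (Real.exp c * ∑ a', Real.exp (ψ s a' θ₂)) :=
        mul_le_mul hnum hsum (hZ θ₁).le (by positivity)
    _ = Real.exp c * Real.exp c * Real.exp (ψ s a θ₁) * ∑ a', Real.exp (ψ s a' θ₂) := by ring

/-- If each `θ ↦ ψ(s,a;θ)` has gradient of norm at most `ℓψ`, then for any
length-`H` trajectory `τ` and any `t ≤ H - 1`, the importance sampling weight
`ω_t(τ|π_{θ₁},π_{θ₂}) = ∏_{h=0}^{t} π_{θ₂}(a_h|s_h) / π_{θ₁}(a_h|s_h)` is bounded by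
`exp (2 (t+1) ℓψ ‖θ₁ - θ₂‖)`. -/
theorem importance_weight_le {S A : Type*} [Fintype S] [Fintype A] [Nonempty S] [Nonempty A]
    {d : ℕ} (ψ : S → A → EuclideanSpace ℝ (Fin d) → ℝ)
    (ψ' : S → A → EuclideanSpace ℝ (Fin d) → EuclideanSpace ℝ (Fin d))
    (ℓψ : ℝ) (hℓ : 0 ≤ ℓψ)
    (hdiff : ∀ s a θ, HasGradientAt (ψ s a) (ψ' s a θ) θ)
    (hbound : ∀ s a θ, ‖ψ' s a θ‖ ≤ ℓψ)
    {H : ℕ} (hH : 1 ≤ H) (τ : Fin H → S × A)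
    (θ₁ θ₂ : EuclideanSpace ℝ (Fin d)) (t : Fin H) :
    ∏ h ∈ Finset.Iic t,
        softmaxPolicy ψ θ₂ (τ h).1 (τ h).2 / softmaxPolicy ψ θ₁ (τ h).1 (τ h).2 ≤
      Real.exp (2 * ((t : ℕ) + 1) * ℓψ * ‖θ₁ - θ₂‖) := by
  calc _ ≤ ∏ _h ∈ Finset.Iic t, Real.exp (2 * (ℓψ * ‖θ₁ - θ₂‖)) :=
        Finset.prod_le_prod
          (fun _ _ => (div_pos (softmaxPolicy_pos ..) (softmaxPolicy_pos ..)).le)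
          (fun h _ => softmaxPolicy_div_le (fun a => abs_sub_le_of_hasGradientAt_norm_le
            (hdiff (τ h).1 a) (hbound (τ h).1 a) θ₂ θ₁) _)
    _ = _ := by
        rw [Finset.prod_const, Fin.card_Iic, ← Real.exp_nat_mul]
        push_cast
        ring_nf
end

section
/- Suppose that for every (s,a) ∈ 𝒮 × 𝒜 the map θ ↦ ψ(s,a;θ) is differentiable on ℝ^d with ‖∇_θ ψ(s,a;θ)‖ ≤ ℓ_ψ for all θ, where ℓ_ψ ≥ 0. Then for every state-action pair (s,a) and every θ ∈ ℝ^d, the gradient of the log-policy satisfies ‖∇_θ log π_θ(a|s)‖ ≤ 2 ℓ_ψ. -/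
open Finset

theorem norm_gradient_eq_norm_fderiv {F : Type*} [NormedAddCommGroup F] [InnerProductSpace ℝ F]
    [CompleteSpace F] (f : F → ℝ) (x : F) : ‖gradient f x‖ = ‖fderiv ℝ f x‖ := by
  rw [gradient, LinearIsometryEquiv.norm_map]

theorem hasFDerivAt_log_sum_exp {ι E : Type*} [Fintype ι] [Nonempty ι]
    [NormedAddCommGroup E] [NormedSpace ℝ E] {f : ι → E → ℝ} {f' : ι → E →L[ℝ] ℝ} {x : E}
    (hf : ∀ i, HasFDerivAt (f i) (f' i) x) :
    HasFDerivAt (fun y => Real.log (∑ i, Real.exp (f i y)))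
      ((∑ i, Real.exp (f i x))⁻¹ • ∑ i, Real.exp (f i x) • f' i) x := by
  have hpos : 0 < ∑ i, Real.exp (f i x) :=
    Finset.sum_pos (fun i _ => Real.exp_pos _) Finset.univ_nonempty
  exact (HasFDerivAt.fun_sum fun i _ => (hf i).exp).log hpos.ne'

/-- A weighted average of vectors of norm at most `C` has norm at most `C`. -/
theorem norm_inv_sum_smul_sum_smul_le {ι E : Type*} [Fintype ι] [Nonempty ι]
    [SeminormedAddCommGroup E] [NormedSpace ℝ E] {w : ι → ℝ} {v : ι → E} {C : ℝ}
    (hw : ∀ i, 0 < w i) (hv : ∀ i, ‖v i‖ ≤ C) :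
    ‖(∑ i, w i)⁻¹ • ∑ i, w i • v i‖ ≤ C := by
  have hpos : 0 < ∑ i, w i := Finset.sum_pos (fun i _ => hw i) Finset.univ_nonempty
  rw [norm_smul, Real.norm_of_nonneg (inv_nonneg.2 hpos.le), inv_mul_le_iff₀ hpos,
    Finset.sum_mul]
  refine norm_sum_le_of_le _ fun i _ => ?_
  rw [norm_smul, Real.norm_of_nonneg (hw i).le]
  exact mul_le_mul_of_nonneg_left (hv i) (hw i).le

theorem log_softmaxPolicy {S A : Type*} [Fintype A] [Nonempty A] {d : ℕ}
    (ψ : S → A → EuclideanSpace ℝ (Fin d) → ℝ)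
    (θ : EuclideanSpace ℝ (Fin d)) (s : S) (a : A) :
    Real.log (softmaxPolicy ψ θ s a) = ψ s a θ - Real.log (∑ a', Real.exp (ψ s a' θ)) := by
  have hpos : 0 < ∑ a', Real.exp (ψ s a' θ) :=
    Finset.sum_pos (fun a' _ => Real.exp_pos _) Finset.univ_nonempty
  rw [softmaxPolicy, Real.log_div (Real.exp_pos _).ne' hpos.ne', Real.log_exp]

/-- If each `θ ↦ ψ(s,a;θ)` is differentiable with gradient norm at most `ℓψ`,
then the gradient of the log soft-max policy satisfies `‖∇_θ log π_θ(a|s)‖ ≤ 2 ℓψ`. -/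
theorem norm_gradient_log_softmaxPolicy_le {S A : Type*} [Fintype S] [Fintype A]
    [Nonempty S] [Nonempty A] {d : ℕ}
    (ψ : S → A → EuclideanSpace ℝ (Fin d) → ℝ)
    (ℓψ : ℝ) (hℓ : 0 ≤ ℓψ)
    (hdiff : ∀ s a, Differentiable ℝ (ψ s a))
    (hbound : ∀ s a θ, ‖gradient (ψ s a) θ‖ ≤ ℓψ)
    (s : S) (a : A) (θ : EuclideanSpace ℝ (Fin d)) :
    ‖gradient (fun θ' => Real.log (softmaxPolicy ψ θ' s a)) θ‖ ≤ 2 * ℓψ := by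
  have hder : ∀ a', HasFDerivAt (ψ s a') (fderiv ℝ (ψ s a') θ) θ :=
    fun a' => (hdiff s a' θ).hasFDerivAt
  have hnorm : ∀ a', ‖fderiv ℝ (ψ s a') θ‖ ≤ ℓψ := fun a' =>
    (norm_gradient_eq_norm_fderiv (ψ s a') θ).symm.trans_le (hbound s a' θ)
  simp only [log_softmaxPolicy]
  rw [norm_gradient_eq_norm_fderiv, ((hder a).fun_sub (hasFDerivAt_log_sum_exp hder)).fderiv,
    two_mul]
  exact norm_sub_le_of_le (hnorm a)
    (norm_inv_sum_smul_sum_smul_le (fun a' => Real.exp_pos _) hnorm)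
end

section
/- Let (Ω, ℱ, ℙ) be a probability space, θ : Ω → ℝ^d a measurable random vector, and g : ℝ^d → ℝ^d a measurable map satisfying ‖g(x)‖ ≤ M for all x ∈ ℝ^d, where M ≥ 0. Fix η > 0, δ > 0, ε ≥ 0, and define the truncated gradient mapping 𝒢(x) = g(x) if η‖g(x)‖ ≤ δ, and 𝒢(x) = (δ/η)·g(x)/‖g(x)‖ otherwise. If 𝔼[‖𝒢(θ)‖] ≤ ε, then 𝔼[‖g(θ)‖] ≤ (1 + (η/δ)·M)·ε. -/
open MeasureTheory

/-- Rescaling `v` to norm `δ / η` when the step `η * ‖v‖` exceeds `δ` truncates its norm at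
`δ / η`. -/
theorem norm_ite_truncate {E : Type*} [NormedAddCommGroup E] [NormedSpace ℝ E] {η δ : ℝ}
    (hη : 0 < η) (hδ : 0 < δ) (v : E) :
    ‖if η * ‖v‖ ≤ δ then v else (δ / η) • ‖v‖⁻¹ • v‖ = min ‖v‖ (δ / η) := by
  have hiff : ‖v‖ ≤ δ / η ↔ η * ‖v‖ ≤ δ := le_div_iff₀' hη
  split_ifs with hv
  · exact (min_eq_left (hiff.2 hv)).symm
  · have hlt : δ / η < ‖v‖ := not_le.1 (mt hiff.1 hv)
    have hpos : 0 < δ / η := by positivity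
    have hne : ‖v‖ ≠ 0 := (hpos.trans hlt).ne'
    rw [min_eq_right hlt.le, norm_smul, norm_smul, norm_inv, norm_norm, inv_mul_cancel₀ hne,
      mul_one, Real.norm_of_nonneg hpos.le]

/-- A number bounded by `M` is controlled by its truncation at `r`. -/
theorem le_one_add_div_mul_min {a M r : ℝ} (ha : 0 ≤ a) (haM : a ≤ M) (hr : 0 < r) :
    a ≤ (1 + M / r) * min a r := by
  have hM : 0 ≤ M := ha.trans haM
  rcases le_total a r with har | hra
  · rw [min_eq_left har]
    exact le_mul_of_one_le_left ha (le_add_of_nonneg_right (by positivity))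
  · rw [min_eq_right hra, add_mul, div_mul_cancel₀ M hr.ne']
    linarith

/-- Let `θ` be a random vector on a probability space, `g` a measurable map
bounded in norm by `M`, and `𝒢` the truncated gradient mapping with step size `η` and radius
`δ`. If `𝔼[‖𝒢(θ)‖] ≤ ε` then `𝔼[‖g(θ)‖] ≤ (1 + (η/δ)·M)·ε`. -/
theorem expectation_norm_truncated_grad {Ω : Type*} [MeasurableSpace Ω]
    (μ : Measure Ω) [IsProbabilityMeasure μ] {d : ℕ}
    (θ : Ω → EuclideanSpace ℝ (Fin d)) (hθ : Measurable θ)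
    (g : EuclideanSpace ℝ (Fin d) → EuclideanSpace ℝ (Fin d)) (hg : Measurable g)
    (M : ℝ) (hM : 0 ≤ M) (hgM : ∀ x, ‖g x‖ ≤ M)
    (η δ ε : ℝ) (hη : 0 < η) (hδ : 0 < δ) (hε : 0 ≤ ε)
    (G : EuclideanSpace ℝ (Fin d) → EuclideanSpace ℝ (Fin d))
    (hG : ∀ x, G x = if η * ‖g x‖ ≤ δ then g x else (δ / η) • ‖g x‖⁻¹ • g x)
    (h : ∫ ω, ‖G (θ ω)‖ ∂μ ≤ ε) :
    ∫ ω, ‖g (θ ω)‖ ∂μ ≤ (1 + (η / δ) * M) * ε := by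
  have hr : 0 < δ / η := by positivity
  have hnorm : ∀ x, ‖G x‖ = min ‖g x‖ (δ / η) := fun x => by
    rw [hG x, norm_ite_truncate hη hδ]
  have hmeas : Measurable fun ω => ‖g (θ ω)‖ := (hg.comp hθ).norm
  have hint : Integrable (fun ω => ‖g (θ ω)‖) μ :=
    Integrable.of_bound hmeas.aestronglyMeasurable M
      (Filter.Eventually.of_forall fun ω => by simpa using hgM (θ ω))
  have hintG : Integrable (fun ω => ‖G (θ ω)‖) μ := by
    simp only [hnorm]
    exact hint.inf (integrable_const _)
  have hcoef : (η / δ) * M = M / (δ / η) := by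
    field_simp
  rw [hcoef]
  calc ∫ ω, ‖g (θ ω)‖ ∂μ ≤ ∫ ω, (1 + M / (δ / η)) * ‖G (θ ω)‖ ∂μ :=
        integral_mono hint (hintG.const_mul _) fun ω => by
          simpa only [hnorm] using le_one_add_div_mul_min (norm_nonneg _) (hgM (θ ω)) hr
    _ = (1 + M / (δ / η)) * ∫ ω, ‖G (θ ω)‖ ∂μ := integral_const_mul _ _
    _ ≤ (1 + M / (δ / η)) * ε := mul_le_mul_of_nonneg_left h (by positivity)
end

section
/- Let F : ℝ^d → ℝ be differentiable with ∇F Lipschitz continuous with constant L > 0. Fix θ₀ ∈ ℝ^d, g ∈ ℝ^d, η > 0 and δ > 0. Let θ₊ = θ₀ + η·g if η‖g‖ ≤ δ and θ₊ = θ₀ + δ·g/‖g‖ otherwise; let θ̂ = θ₀ + η·∇F(θ₀) if η‖∇F(θ₀)‖ ≤ δ and θ̂ = θ₀ + δ·∇F(θ₀)/‖∇F(θ₀)‖ otherwise; and let 𝒢 = (θ̂ − θ₀)/η. Then F(θ₊) ≥ F(θ₀) + (η/4)‖𝒢‖² + (1/(2η) − L)‖θ₊ − θ₀‖² − (η/2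 + 1/(2L))‖∇F(θ₀) − g‖². -/
open scoped InnerProductSpace

section

variable {E : Type*} [NormedAddCommGroup E] [InnerProductSpace ℝ E]

/-- Quadratic lower bound for a function with `L`-Lipschitz gradient. -/
theorem add_inner_gradient_sub_le_of_lipschitz [CompleteSpace E] {F : E → ℝ} {L : ℝ}
    (hdiff : Differentiable ℝ F)
    (hlip : ∀ x y, ‖gradient F x - gradient F y‖ ≤ L * ‖x - y‖) (x v : E) :
    F x + ⟪gradient F x, v⟫_ℝ - L / 2 * ‖v‖ ^ 2 ≤ F (x + v) := by
  have hline (t : ℝ) : HasDerivAt (fun t : ℝ ↦ x + t • v) v t := by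
    simpa using ((hasDerivAt_id t).smul_const v).const_add x
  have hF (t : ℝ) :
      HasDerivAt (fun t : ℝ ↦ F (x + t • v)) ⟪gradient F (x + t • v), v⟫_ℝ t := by
    simpa [Function.comp_def] using
      (hdiff (x + t • v)).hasGradientAt.hasFDerivAt.comp_hasDerivAt t (hline t)
  have hφ (t : ℝ) : HasDerivAt
      (fun t : ℝ ↦ F (x + t • v) - t * ⟪gradient F x, v⟫_ℝ + t ^ 2 * (L / 2 * ‖v‖ ^ 2))
      (⟪gradient F (x + t • v), v⟫_ℝ - ⟪gradient F x, v⟫_ℝ + 2 * t * (L / 2 * ‖v‖ ^ 2)) t := by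
    simpa using ((hF t).fun_sub ((hasDerivAt_id t).mul_const ⟪gradient F x, v⟫_ℝ)).fun_add
      ((hasDerivAt_pow 2 t).mul_const (L / 2 * ‖v‖ ^ 2))
  have hmono := monotoneOn_of_hasDerivWithinAt_nonneg (convex_Icc (0 : ℝ) 1)
    (fun t _ ↦ (hφ t).continuousAt.continuousWithinAt)
    (fun t _ ↦ (hφ t).hasDerivWithinAt) (fun t ht ↦ by
      have ht0 : 0 ≤ t := (interior_subset ht).1
      have hgrad : ‖gradient F (x + t • v) - gradient F x‖ ≤ L * (t * ‖v‖) := by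
        simpa [norm_smul, abs_of_nonneg ht0] using hlip (x + t • v) x
      have hinner := neg_le_of_abs_le
        (abs_real_inner_le_norm (gradient F (x + t • v) - gradient F x) v)
      rw [inner_sub_left] at hinner
      nlinarith [mul_le_mul_of_nonneg_right hgrad (norm_nonneg v)])
  have h01 := hmono (Set.left_mem_Icc.2 zero_le_one) (Set.right_mem_Icc.2 zero_le_one)
    (zero_le_one (α := ℝ))
  simp only [zero_smul, add_zero, zero_mul, sub_zero, one_smul, one_mul, one_pow, ne_eq,
    OfNat.ofNat_ne_zero, not_false_eq_true, zero_pow] at h01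
  linarith

/-- A truncated step has norm `min (η‖v‖) δ` and is positively aligned with its direction. -/
theorem norm_truncated_step_eq_and_sq_le_inner {η δ : ℝ} (hη : 0 < η) (hδ : 0 < δ)
    {v x y : E}
    (hy : y = if η * ‖v‖ ≤ δ then x + η • v else x + δ • ‖v‖⁻¹ • v) :
    ‖y - x‖ = min (η * ‖v‖) δ ∧ ‖y - x‖ ^ 2 ≤ η * ⟪v, y - x⟫_ℝ := by
  split_ifs at hy with h
  · have hyx : y - x = η • v := by simp [hy]
    rw [hyx, norm_smul, Real.norm_of_nonneg hη.le, inner_smul_right,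
      real_inner_self_eq_norm_sq, min_eq_left h]
    exact ⟨rfl, le_of_eq (by ring)⟩
  · push Not at h
    have hv : 0 < ‖v‖ := pos_of_mul_pos_right (hδ.trans h) hη.le
    have hyx : y - x = δ • ‖v‖⁻¹ • v := by simp [hy]
    have hnorm : ‖y - x‖ = δ := by
      rw [hyx, norm_smul, norm_smul, norm_inv, norm_norm, inv_mul_cancel₀ hv.ne', mul_one,
        Real.norm_of_nonneg hδ.le]
    have hinner : ⟪v, y - x⟫_ℝ = δ * ‖v‖ := by
      rw [hyx, inner_smul_right, inner_smul_right, real_inner_self_eq_norm_sq]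
      field_simp
    rw [hinner, hnorm]
    exact ⟨(min_eq_right h.le).symm, by nlinarith⟩

end

/-- Per-iteration ascent of the truncated gradient step: if `F` is
differentiable with `L`-Lipschitz gradient, `θp` is the truncated step with direction `g`,
`θhat` the truncated step with the exact gradient, and `Gm = (θhat − θ₀)/η` the gradient
mapping, then
`F θp ≥ F θ₀ + (η/4)‖Gm‖² + (1/(2η) − L)‖θp − θ₀‖² − (η/2 + 1/(2L))‖∇F(θ₀) − g‖²`. -/
theorem truncated_step_ascent {d : ℕ}
    (F : EuclideanSpace ℝ (Fin d) → ℝ) (L : ℝ) (hL : 0 < L)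
    (hdiff : Differentiable ℝ F)
    (hlip : ∀ x y, ‖gradient F x - gradient F y‖ ≤ L * ‖x - y‖)
    (θ₀ g : EuclideanSpace ℝ (Fin d)) (η δ : ℝ) (hη : 0 < η) (hδ : 0 < δ)
    (θp θhat Gm : EuclideanSpace ℝ (Fin d))
    (hθp : θp = if η * ‖g‖ ≤ δ then θ₀ + η • g else θ₀ + δ • ‖g‖⁻¹ • g)
    (hθhat : θhat =
      if η * ‖gradient F θ₀‖ ≤ δ then θ₀ + η • gradient F θ₀
      else θ₀ + δ • ‖gradient F θ₀‖⁻¹ • gradient F θ₀)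
    (hGm : Gm = (1 / η) • (θhat - θ₀)) :
    F θp ≥ F θ₀ + (η / 4) * ‖Gm‖ ^ 2 + (1 / (2 * η) - L) * ‖θp - θ₀‖ ^ 2 -
      (η / 2 + 1 / (2 * L)) * ‖gradient F θ₀ - g‖ ^ 2 := by
  obtain ⟨hp, hpg⟩ := norm_truncated_step_eq_and_sq_le_inner hη hδ hθp
  obtain ⟨hq, -⟩ := norm_truncated_step_eq_and_sq_le_inner hη hδ hθhat
  have hF := add_inner_gradient_sub_le_of_lipschitz hdiff hlip θ₀ (θp - θ₀)
  rw [add_sub_cancel] at hF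
  have hGm_norm : ‖Gm‖ = ‖θhat - θ₀‖ / η := by
    rw [hGm, norm_smul, Real.norm_of_nonneg (by positivity)]
    ring
  have hyoung : -(1 / (2 * L) * ‖gradient F θ₀ - g‖ ^ 2 + L / 2 * ‖θp - θ₀‖ ^ 2) ≤
      ⟪gradient F θ₀ - g, θp - θ₀⟫_ℝ := by
    have hsq : 1 / (2 * L) * ‖gradient F θ₀ - g‖ ^ 2 + L / 2 * ‖θp - θ₀‖ ^ 2 -
        ‖gradient F θ₀ - g‖ * ‖θp - θ₀‖ =
        (‖gradient F θ₀ - g‖ - L * ‖θp - θ₀‖) ^ 2 / (2 * L) := by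
      field_simp
      ring
    have hnonneg : 0 ≤ (‖gradient F θ₀ - g‖ - L * ‖θp - θ₀‖) ^ 2 / (2 * L) := by positivity
    have := neg_le_of_abs_le (abs_real_inner_le_norm (gradient F θ₀ - g) (θp - θ₀))
    linarith
  rw [inner_sub_left] at hyoung
  have hle : ‖θhat - θ₀‖ ≤ ‖θp - θ₀‖ + η * ‖gradient F θ₀ - g‖ := by
    have htri : η * ‖gradient F θ₀‖ ≤ η * ‖g‖ + η * ‖gradient F θ₀ - g‖ := by
      rw [← mul_add]
      gcongr
      exact norm_le_insert' _ _
    have hnonneg : 0 ≤ η * ‖gradient F θ₀ - g‖ := by positivity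
    rw [hp, hq, min_add, le_min_iff]
    exact ⟨(min_le_left _ _).trans htri, (min_le_right _ _).trans (by linarith)⟩
  have hsq : ‖θhat - θ₀‖ ^ 2 ≤ 2 * ‖θp - θ₀‖ ^ 2 + 2 * (η * ‖gradient F θ₀ - g‖) ^ 2 := by
    nlinarith [pow_le_pow_left₀ (norm_nonneg _) hle 2,
      sq_nonneg (‖θp - θ₀‖ - η * ‖gradient F θ₀ - g‖)]
  have hstep : η / 4 * ‖Gm‖ ^ 2 + 1 / (2 * η) * ‖θp - θ₀‖ ^ 2 -
      η / 2 * ‖gradient F θ₀ - g‖ ^ 2 ≤ ⟪g, θp - θ₀⟫_ℝ := by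
    have heq : η / 4 * ‖Gm‖ ^ 2 + 1 / (2 * η) * ‖θp - θ₀‖ ^ 2 -
        η / 2 * ‖gradient F θ₀ - g‖ ^ 2 = (‖θhat - θ₀‖ ^ 2 + 2 * ‖θp - θ₀‖ ^ 2 -
          2 * (η * ‖gradient F θ₀ - g‖) ^ 2) / (4 * η) := by
      rw [hGm_norm]
      field_simp
      ring
    rw [heq, div_le_iff₀ (by positivity)]
    linarith
  linarith
end

section
/- Let F : ℝ^d → ℝ be differentiable with ∇F Lipschitz continuous with constant L > 0. Fix θ₀ ∈ ℝ^d, g ∈ ℝ^d, η > 0 and δ > 0, and let θ₊ = θ₀ + η·g if η‖g‖ ≤ δ and θ₊ = θ₀ + δ·g/‖g‖ otherwise. Then for every θ with ‖θ − θ₀‖ ≤ δ, F(θ₊) ≥ F(θ) − (L + 1/(2η))·‖θ − θ₀‖² + (1/(2η) − L)·‖θ₊ − θ₀‖² − (1/L)·‖g − ∇F(θ₀)‖². -/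
open scoped RealInnerProductSpace

/-- A function with `L`-Lipschitz gradient deviates from its first-order expansion by at most
`L / 2 * ‖v‖ ^ 2`. -/
theorem abs_sub_sub_inner_gradient_le {E : Type*} [NormedAddCommGroup E] [InnerProductSpace ℝ E]
    [CompleteSpace E] {F : E → ℝ} {L : ℝ} (hdiff : Differentiable ℝ F)
    (hlip : ∀ x y, ‖gradient F x - gradient F y‖ ≤ L * ‖x - y‖) (x v : E) :
    |F (x + v) - F x - ⟪gradient F x, v⟫| ≤ L / 2 * ‖v‖ ^ 2 := by
  have hder (t : ℝ) : HasDerivAt (fun t : ℝ ↦ F (x + t • v) - F x - t * ⟪gradient F x, v⟫)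
      (⟪gradient F (x + t • v) - gradient F x, v⟫) t := by
    have hline : HasDerivAt (fun t : ℝ ↦ x + t • v) v t := by
      simpa using ((hasDerivAt_id t).smul_const v).const_add x
    have hF := (hdiff (x + t • v)).hasGradientAt.hasFDerivAt.comp_hasDerivAt t hline
    have h := (hF.sub_const (F x)).sub ((hasDerivAt_id t).mul_const ⟪gradient F x, v⟫)
    exact h.congr_deriv (by simp [inner_sub_left])
  have hbound (t : ℝ) :
      HasDerivAt (fun t : ℝ ↦ L / 2 * ‖v‖ ^ 2 * t ^ 2) (L * ‖v‖ ^ 2 * t) t :=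
    ((hasDerivAt_pow 2 t).const_mul (L / 2 * ‖v‖ ^ 2)).congr_deriv (by push_cast; ring)
  have key := image_norm_le_of_norm_deriv_right_le_deriv_boundary (a := 0) (b := 1)
    (fun t _ ↦ (hder t).continuousAt.continuousWithinAt)
    (fun t _ ↦ (hder t).hasDerivWithinAt) (by simp) hbound
    (fun t ht ↦ by
      calc ‖⟪gradient F (x + t • v) - gradient F x, v⟫‖
          ≤ ‖gradient F (x + t • v) - gradient F x‖ * ‖v‖ := norm_inner_le_norm _ _
        _ ≤ L * ‖x + t • v - x‖ * ‖v‖ := by gcongr; exact hlip _ _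
        _ = L * ‖v‖ ^ 2 * t := by
          rw [add_sub_cancel_left, norm_smul, Real.norm_of_nonneg ht.1]
          ring)
    (Set.right_mem_Icc.2 zero_le_one)
  simpa using key

/-- Young's inequality for inner products. -/
theorem real_inner_le_norm_sq_div_add {E : Type*} [NormedAddCommGroup E] [InnerProductSpace ℝ E]
    {L : ℝ} (hL : 0 < L) (e v : E) :
    ⟪e, v⟫ ≤ 1 / (2 * L) * ‖e‖ ^ 2 + L / 2 * ‖v‖ ^ 2 := by
  have h := real_inner_le_norm e v
  have hsq : 1 / (2 * L) * ‖e‖ ^ 2 + L / 2 * ‖v‖ ^ 2 - ‖e‖ * ‖v‖ =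
      (‖e‖ - L * ‖v‖) ^ 2 / (2 * L) := by
    field_simp
    ring
  have : 0 ≤ (‖e‖ - L * ‖v‖) ^ 2 / (2 * L) := by positivity
  linarith

/-- The truncated gradient displacement maximizes `v ↦ ⟪g, v⟫ - 1 / (2 * η) * ‖v‖ ^ 2` over the
closed ball of radius `δ`. -/
theorem inner_sub_norm_sq_le_truncated {E : Type*} [NormedAddCommGroup E] [InnerProductSpace ℝ E]
    {g u p : E} {η δ : ℝ} (hη : 0 < η) (hδ : 0 < δ)
    (hp : p = if η * ‖g‖ ≤ δ then η • g else δ • ‖g‖⁻¹ • g) (hu : ‖u‖ ≤ δ) :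
    ⟪g, u⟫ - 1 / (2 * η) * ‖u‖ ^ 2 ≤ ⟪g, p⟫ - 1 / (2 * η) * ‖p‖ ^ 2 := by
  split_ifs at hp with h
  · have hY := real_inner_le_norm_sq_div_add (one_div_pos.2 hη) g u
    have hgp : ⟪g, p⟫ - 1 / (2 * η) * ‖p‖ ^ 2 = η / 2 * ‖g‖ ^ 2 := by
      rw [hp, real_inner_smul_right, real_inner_self_eq_norm_sq, norm_smul,
        Real.norm_of_nonneg hη.le]
      field_simp
      ring
    rw [hgp]
    have h₁ : 1 / (2 * (1 / η)) = η / 2 := by field_simp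
    have h₂ : 1 / η / 2 = 1 / (2 * η) := by field_simp
    rw [h₁, h₂] at hY
    linarith
  · push Not at h
    have hg : 0 < ‖g‖ := pos_of_mul_pos_right (hδ.trans h) hη.le
    have hgp : ⟪g, p⟫ = δ * ‖g‖ := by
      rw [hp, real_inner_smul_right, real_inner_smul_right, real_inner_self_eq_norm_sq]
      field_simp
    have hnp : ‖p‖ = δ := by
      rw [hp, norm_smul, norm_smul, norm_inv, norm_norm, inv_mul_cancel₀ hg.ne', mul_one,
        Real.norm_of_nonneg hδ.le]
    have hgu := real_inner_le_norm g u
    have hfac : 1 / (2 * η) * (δ + ‖u‖) ≤ ‖g‖ := by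
      rw [one_div, inv_mul_le_iff₀ (by positivity)]
      linarith
    rw [hgp, hnp]
    nlinarith [mul_le_mul_of_nonneg_right hfac (sub_nonneg.2 hu)]

/-- If `F` is differentiable with `L`-Lipschitz gradient and `θp` is the
truncated gradient step from `θ₀` with direction `g`, then for every `θ` in the closed ball
of radius `δ` around `θ₀`,
`F θp ≥ F θ − (L + 1/(2η))‖θ − θ₀‖² + (1/(2η) − L)‖θp − θ₀‖² − (1/L)‖g − ∇F(θ₀)‖²`. -/
theorem truncated_step_dominates_ball {d : ℕ}
    (F : EuclideanSpace ℝ (Fin d) → ℝ) (L : ℝ) (hL : 0 < L)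
    (hdiff : Differentiable ℝ F)
    (hlip : ∀ x y, ‖gradient F x - gradient F y‖ ≤ L * ‖x - y‖)
    (θ₀ g : EuclideanSpace ℝ (Fin d)) (η δ : ℝ) (hη : 0 < η) (hδ : 0 < δ)
    (θp : EuclideanSpace ℝ (Fin d))
    (hθp : θp = if η * ‖g‖ ≤ δ then θ₀ + η • g else θ₀ + δ • ‖g‖⁻¹ • g)
    (θ : EuclideanSpace ℝ (Fin d)) (hθ : ‖θ - θ₀‖ ≤ δ) :
    F θp ≥ F θ - (L + 1 / (2 * η)) * ‖θ - θ₀‖ ^ 2 +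
      (1 / (2 * η) - L) * ‖θp - θ₀‖ ^ 2 - (1 / L) * ‖g - gradient F θ₀‖ ^ 2 := by
  have hp : θp - θ₀ = if η * ‖g‖ ≤ δ then η • g else δ • ‖g‖⁻¹ • g := by
    rw [hθp]
    split_ifs <;> simp
  have hopt := inner_sub_norm_sq_le_truncated hη hδ hp hθ
  have hlower := (abs_le.1 (abs_sub_sub_inner_gradient_le hdiff hlip θ₀ (θp - θ₀))).1
  have hupper := (abs_le.1 (abs_sub_sub_inner_gradient_le hdiff hlip θ₀ (θ - θ₀))).2
  rw [add_sub_cancel] at hlower hupper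
  have hYp := real_inner_le_norm_sq_div_add hL (g - gradient F θ₀) (θp - θ₀)
  have hYu := real_inner_le_norm_sq_div_add hL (gradient F θ₀ - g) (θ - θ₀)
  rw [norm_sub_rev (gradient F θ₀) g] at hYu
  rw [inner_sub_left] at hYp hYu
  have hhalf : 1 / L = 1 / (2 * L) + 1 / (2 * L) := by
    field_simp
    norm_num
  rw [hhalf]
  linarith
end

section
/- Let π₁, π₂ be two policies with π₁(a|s) > 0 for every (s,a), fix H ≥ 1 and γ ∈ (0,1). Then the off-policy occupancy estimator is unbiased for the truncated occupancy measure of the target policy: Σ_{τ ∈ (𝒮×𝒜)^H} p(τ|π₁) · λ̂_ω(τ|π₁,π₂) = λ_H(π₂), where the equality holds in every coordinate (s,a) ∈ 𝒮×𝒜. -/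
open Finset

/-- The probability of a length-`H` trajectory `τ` under initial distribution `ξ`,
transition kernel `P` and policy `π`:
`p(τ|π) = ξ(s₀) π(a₀|s₀) ∏_{t=1}^{H−1} P(s_t|s_{t−1},a_{t−1}) π(a_t|s_t)`. -/
noncomputable def trajProb {S A : Type*} [Fintype S] [Fintype A] {H : ℕ}
    (ξ : S → ℝ) (P : S → A → S → ℝ) (π : S → A → ℝ) (τ : Fin H → S × A) : ℝ :=
  ∏ t : Fin H,
    (if (t : ℕ) = 0 then ξ (τ t).1
      else P (τ ⟨(t : ℕ) - 1, lt_of_le_of_lt (Nat.pred_le _) t.isLt⟩).1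
             (τ ⟨(t : ℕ) - 1, lt_of_le_of_lt (Nat.pred_le _) t.isLt⟩).2 (τ t).1) *
      π (τ t).1 (τ t).2

/-- The importance sampling weight `ω_t(τ|π₁,π₂) = ∏_{h=0}^{t} π₂(a_h|s_h)/π₁(a_h|s_h)`. -/
noncomputable def impWeight {S A : Type*} {H : ℕ} (π₁ π₂ : S → A → ℝ)
    (τ : Fin H → S × A) (t : Fin H) : ℝ :=
  ∏ h ∈ Finset.Iic t, π₂ (τ h).1 (τ h).2 / π₁ (τ h).1 (τ h).2

/-- `ℙ(s_t = s, a_t = a | π, s₀ ∼ ξ)`: the probability that at step `t` the state-action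
pair is `(s,a)`, i.e. the sum of `p(τ'|π)` over all length-`(t+1)` trajectories whose last
state-action pair is `(s,a)`. -/
noncomputable def stepProb {S A : Type*} [Fintype S] [Fintype A] [DecidableEq S]
    [DecidableEq A] (ξ : S → ℝ) (P : S → A → S → ℝ) (π : S → A → ℝ)
    (t : ℕ) (s : S) (a : A) : ℝ :=
  ∑ τ : Fin (t + 1) → S × A,
    if τ (Fin.last t) = (s, a) then trajProb ξ P π τ else 0

/-- The off-policy occupancy estimator
`λ̂_ω(τ|π₁,π₂)(s,a) = Σ_{t=0}^{H−1} γ^t ω_t(τ|π₁,π₂) 1[(s_t,a_t) = (s,a)]`. -/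
noncomputable def occEstimator {S A : Type*} [DecidableEq S] [DecidableEq A]
    (γ : ℝ) (π₁ π₂ : S → A → ℝ) {H : ℕ} (τ : Fin H → S × A) (s : S) (a : A) : ℝ :=
  ∑ t : Fin H, γ ^ (t : ℕ) * impWeight π₁ π₂ τ t * (if τ t = (s, a) then 1 else 0)

/-- Appending a state-action pair to a trajectory and summing it out leaves the
probability of the trajectory unchanged. -/
theorem sum_trajProb_snoc {S A : Type*} [Fintype S] [Fintype A]
    {ξ : S → ℝ} (hξ : ∑ s, ξ s = 1) {P : S → A → S → ℝ} (hP : ∀ s a, ∑ s', P s a s' = 1)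
    {π : S → A → ℝ} (hπ : ∀ s, ∑ a, π s a = 1) {n : ℕ} (τ : Fin n → S × A) :
    ∑ x : S × A, trajProb ξ P π (Fin.snoc τ x : Fin (n + 1) → S × A) = trajProb ξ P π τ := by
  have hsum (q : S → ℝ) (hq : ∑ s, q s = 1) : ∑ x : S × A, q x.1 * π x.1 x.2 = 1 := by
    simp [Fintype.sum_prod_type, ← Finset.mul_sum, hπ, hq]
  have hprev (x : S × A) (t : Fin n) (h : (t : ℕ) - 1 < n + 1) (h' : (t : ℕ) - 1 < n) :
      (Fin.snoc τ x : Fin (n + 1) → S × A) ⟨(t : ℕ) - 1, h⟩ = τ ⟨(t : ℕ) - 1, h'⟩ :=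
    Fin.snoc_castSucc (α := fun _ => S × A) x τ ⟨(t : ℕ) - 1, h'⟩
  simp only [trajProb, Fin.prod_univ_castSucc, Fin.snoc_castSucc, Fin.snoc_last,
    Fin.val_castSucc, Fin.val_last]
  have hcongr (x : S × A) (t : Fin n) := hprev x t (by omega) (by omega)
  simp only [hcongr]
  rw [← Finset.mul_sum]
  refine (congrArg _ ?_).trans (mul_one _)
  cases n with
  | zero => simpa using hsum ξ hξ
  | succ m =>
    have hlast (x : S × A) (h : m + 1 - 1 < m + 1 + 1) :
        (Fin.snoc τ x : Fin (m + 1 + 1) → S × A) ⟨m + 1 - 1, h⟩ = τ (Fin.last m) :=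
      Fin.snoc_castSucc (α := fun _ => S × A) x τ (Fin.last m)
    simp only [hlast, Nat.succ_ne_zero, if_false]
    exact hsum _ (hP _ _)

/-- The expectation of a function of the first `n` steps of a trajectory does not depend on
the number of remaining steps. -/
theorem sum_trajProb_mul_castAdd {S A : Type*} [Fintype S] [Fintype A]
    {ξ : S → ℝ} (hξ : ∑ s, ξ s = 1) {P : S → A → S → ℝ} (hP : ∀ s a, ∑ s', P s a s' = 1)
    {π : S → A → ℝ} (hπ : ∀ s, ∑ a, π s a = 1) {n : ℕ} (f : (Fin n → S × A) → ℝ) (k : ℕ) :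
    ∑ τ : Fin (n + k) → S × A, trajProb ξ P π τ * f (fun i => τ (Fin.castAdd k i)) =
      ∑ τ : Fin n → S × A, trajProb ξ P π τ * f τ := by
  induction k with
  | zero => rfl
  | succ k ih =>
    rw [← ih]
    refine ((Fin.snocEquiv fun _ : Fin (n + k + 1) => S × A).sum_comp _).symm.trans ?_
    rw [Fintype.sum_prod_type_right]
    refine Finset.sum_congr rfl fun τ _ => ?_
    rw [← sum_trajProb_snoc hξ hP hπ τ, Finset.sum_mul]
    refine Finset.sum_congr rfl fun x _ => ?_
    congr 2
    funext i
    exact Fin.snoc_castSucc (α := fun _ => S × A) x τ (Fin.castAdd k i)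

/-- The importance weight at time `t` only depends on the first `t + 1` steps. -/
theorem impWeight_castAdd {S A : Type*} (π₁ π₂ : S → A → ℝ) {n k : ℕ}
    (τ : Fin (n + k) → S × A) (t : Fin n) :
    impWeight π₁ π₂ (fun i => τ (Fin.castAdd k i)) t = impWeight π₁ π₂ τ (Fin.castAdd k t) := by
  rw [impWeight, impWeight, ← Fin.map_castAddEmb_Iic, Finset.prod_map]
  rfl

/-- The importance weight over a full trajectory changes the behaviour policy `π₁` into the
target policy `π₂`. -/
theorem trajProb_mul_impWeight_last {S A : Type*} [Fintype S] [Fintype A]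
    (ξ : S → ℝ) (P : S → A → S → ℝ) {π₁ : S → A → ℝ} (π₂ : S → A → ℝ)
    (hπ₁ : ∀ s a, π₁ s a ≠ 0) {n : ℕ} (τ : Fin (n + 1) → S × A) :
    trajProb ξ P π₁ τ * impWeight π₁ π₂ τ (Fin.last n) = trajProb ξ P π₂ τ := by
  have huniv : Finset.Iic (Fin.last n) = Finset.univ := Finset.Iic_top
  rw [impWeight, huniv, trajProb, trajProb, ← Finset.prod_mul_distrib]
  refine Finset.prod_congr rfl fun t _ => ?_
  rw [mul_assoc, mul_div_cancel₀ _ (hπ₁ _ _)]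

/-- The importance-weighted indicator of visiting `(s, a)` at time `t` is an unbiased estimator
of the probability of this event under the target policy. -/
theorem sum_trajProb_mul_impWeight {S A : Type*} [Fintype S] [Fintype A]
    [DecidableEq S] [DecidableEq A]
    {ξ : S → ℝ} (hξ : ∑ s, ξ s = 1) {P : S → A → S → ℝ} (hP : ∀ s a, ∑ s', P s a s' = 1)
    {π₁ : S → A → ℝ} (π₂ : S → A → ℝ) (hπ₁ne : ∀ s a, π₁ s a ≠ 0)
    (hπ₁ : ∀ s, ∑ a, π₁ s a = 1) {H : ℕ} (t : Fin H) (s : S) (a : A) :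
    ∑ τ : Fin H → S × A,
        trajProb ξ P π₁ τ * (impWeight π₁ π₂ τ t * (if τ t = (s, a) then 1 else 0)) =
      stepProb ξ P π₂ t s a := by
  obtain ⟨t, ht⟩ := t
  obtain ⟨k, rfl⟩ := Nat.exists_eq_add_of_le (Nat.succ_le_of_lt ht)
  have h := sum_trajProb_mul_castAdd hξ hP hπ₁ (n := t + 1)
    (fun τ => impWeight π₁ π₂ τ (Fin.last t) * (if τ (Fin.last t) = (s, a) then 1 else 0)) k
  simp only [impWeight_castAdd] at h
  refine h.trans ?_
  refine Finset.sum_congr rfl fun τ _ => ?_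
  rw [← mul_assoc, trajProb_mul_impWeight_last ξ P π₂ hπ₁ne, mul_ite, mul_one, mul_zero]

/-- The off-policy occupancy estimator is unbiased for the truncated
occupancy measure of the target policy:
`Σ_τ p(τ|π₁) λ̂_ω(τ|π₁,π₂)(s,a) = λ_H(π₂)(s,a) = Σ_{t=0}^{H−1} γ^t ℙ(s_t=s,a_t=a|π₂,ξ)`
for every coordinate `(s,a)`. -/
theorem occEstimator_unbiased {S A : Type*} [Fintype S] [Fintype A]
    [Nonempty S] [Nonempty A] [DecidableEq S] [DecidableEq A]
    (ξ : S → ℝ) (hξ : ∀ s, 0 ≤ ξ s) (hξ1 : ∑ s, ξ s = 1)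
    (P : S → A → S → ℝ) (hP : ∀ s a s', 0 ≤ P s a s') (hP1 : ∀ s a, ∑ s', P s a s' = 1)
    (π₁ π₂ : S → A → ℝ)
    (hπ₁pos : ∀ s a, 0 < π₁ s a) (hπ₁ : ∀ s, ∑ a, π₁ s a = 1)
    (hπ₂nonneg : ∀ s a, 0 ≤ π₂ s a) (hπ₂ : ∀ s, ∑ a, π₂ s a = 1)
    {H : ℕ} (hH : 1 ≤ H) (γ : ℝ) (hγ0 : 0 < γ) (hγ1 : γ < 1)
    (s : S) (a : A) :
    ∑ τ : Fin H → S × A, trajProb ξ P π₁ τ * occEstimator γ π₁ π₂ τ s a =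
      ∑ t ∈ Finset.range H, γ ^ t * stepProb ξ P π₂ t s a := by
  rw [← Fin.sum_univ_eq_sum_range fun t => γ ^ t * stepProb ξ P π₂ t s a]
  simp only [occEstimator, Finset.mul_sum]
  rw [Finset.sum_comm]
  refine Finset.sum_congr rfl fun t _ => ?_
  rw [← sum_trajProb_mul_impWeight hξ1 hP1 π₂ (fun s a => (hπ₁pos s a).ne') hπ₁ t s a,
    Finset.mul_sum]
  refine Finset.sum_congr rfl fun τ _ => ?_
  ring
end

section
/- Suppose that for every (s,a) ∈ 𝒮 × 𝒜 the map θ ↦ ψ(s,a;θ) is twice continuously differentiable on ℝ^d with ‖∇_θ ψ(s,a;θ)‖ ≤ ℓ_ψ and ‖∇²_θ ψ(s,a;θ)‖ ≤ L_ψ for all θ, where ℓ_ψ, L_ψ ≥ 0, and fix γ ∈ (0,1). Then for any H ≥ 1, any length-H trajectory τ, any θ₁, θ₂ ∈ ℝ^d and any reward vector r : 𝒮×𝒜 → ℝ, the REINFORCE estimators satisfy ‖ĝ(τ|θ₁,r) − ĝ(τ|θ₂,r)‖ ≤ (2(ℓ_ψ² + L_ψ)/(1−γ)²) · (max_{(s,a)}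 |r(s,a)|) · ‖θ₁ − θ₂‖. -/
open Finset

/-- The on-policy REINFORCE estimator with quasi-reward `r`:
`ĝ(τ|θ,r) = Σ_{t=0}^{H−1} γ^t r(s_t,a_t) Σ_{t'=0}^{t} ∇_θ log π_θ(a_{t'}|s_{t'})`. -/
noncomputable def reinforceEst {S A : Type*} [Fintype A] {d : ℕ}
    (ψ : S → A → EuclideanSpace ℝ (Fin d) → ℝ) (γ : ℝ) {H : ℕ}
    (τ : Fin H → S × A) (θ : EuclideanSpace ℝ (Fin d)) (r : S × A → ℝ) :
    EuclideanSpace ℝ (Fin d) :=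
  ∑ t : Fin H, (γ ^ (t : ℕ) * r (τ t)) •
    ∑ t' ∈ Finset.Iic t,
      gradient (fun θ' => Real.log (softmaxPolicy ψ θ' (τ t').1 (τ t').2)) θ

section Softmax

variable {A E : Type*} [Fintype A]

/-- The soft-max weights at `θ` of a finite family of real functions. -/
noncomputable def softmaxWeight (φ : A → E → ℝ) (a : A) (θ : E) : ℝ :=
  Real.exp (φ a θ) / ∑ b, Real.exp (φ b θ)

/-- The derivative at `θ` of `log (softmaxWeight φ a)`. -/
noncomputable def softmaxScore [NormedAddCommGroup E] [NormedSpace ℝ E]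
    (φ : A → E → ℝ) (a : A) (θ : E) : E →L[ℝ] ℝ :=
  fderiv ℝ (φ a) θ - ∑ b, softmaxWeight φ b θ • fderiv ℝ (φ b) θ

variable [Nonempty A]

lemma sum_exp_pos (φ : A → E → ℝ) (θ : E) : 0 < ∑ b, Real.exp (φ b θ) :=
  Finset.sum_pos (fun _ _ => Real.exp_pos _) Finset.univ_nonempty

lemma softmaxWeight_pos (φ : A → E → ℝ) (a : A) (θ : E) : 0 < softmaxWeight φ a θ :=
  div_pos (Real.exp_pos _) (sum_exp_pos φ θ)

lemma sum_softmaxWeight (φ : A → E → ℝ) (θ : E) : ∑ a, softmaxWeight φ a θ = 1 := by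
  simp only [softmaxWeight, ← Finset.sum_div]
  exact div_self (sum_exp_pos φ θ).ne'

lemma log_softmaxWeight (φ : A → E → ℝ) (a : A) (θ : E) :
    Real.log (softmaxWeight φ a θ) = φ a θ - Real.log (∑ b, Real.exp (φ b θ)) := by
  rw [softmaxWeight, Real.log_div (Real.exp_pos _).ne' (sum_exp_pos φ θ).ne', Real.log_exp]

/-- A soft-max average of vectors of norm at most `C` has norm at most `C`. -/
lemma norm_sum_softmaxWeight_smul_le {F : Type*} [SeminormedAddCommGroup F] [NormedSpace ℝ F]
    (φ : A → E → ℝ) (θ : E) {v : A → F} {C : ℝ} (hv : ∀ b, ‖v b‖ ≤ C) :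
    ‖∑ b, softmaxWeight φ b θ • v b‖ ≤ C :=
  calc ‖∑ b, softmaxWeight φ b θ • v b‖ ≤ ∑ b, softmaxWeight φ b θ * C := by
        refine norm_sum_le_of_le _ fun b _ => ?_
        rw [norm_smul, Real.norm_of_nonneg (softmaxWeight_pos φ b θ).le]
        exact mul_le_mul_of_nonneg_left (hv b) (softmaxWeight_pos φ b θ).le
    _ = C := by rw [← Finset.sum_mul, sum_softmaxWeight, one_mul]

variable [NormedAddCommGroup E] [NormedSpace ℝ E]

lemma hasFDerivAt_log_softmaxWeight {φ : A → E → ℝ} {θ : E}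
    (hφ : ∀ b, DifferentiableAt ℝ (φ b) θ) (a : A) :
    HasFDerivAt (fun θ' => Real.log (softmaxWeight φ a θ')) (softmaxScore φ a θ) θ := by
  have hsum : HasFDerivAt (fun θ' => ∑ b, Real.exp (φ b θ'))
      (∑ b, Real.exp (φ b θ) • fderiv ℝ (φ b) θ) θ :=
    HasFDerivAt.fun_sum fun b _ => (hφ b).hasFDerivAt.exp
  simp only [log_softmaxWeight]
  refine ((hφ a).hasFDerivAt.fun_sub (hsum.log (sum_exp_pos φ θ).ne')).congr_fderiv ?_
  simp only [softmaxScore, softmaxWeight, Finset.smul_sum, smul_smul, div_eq_inv_mul]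

lemma hasFDerivAt_softmaxWeight {φ : A → E → ℝ} {θ : E}
    (hφ : ∀ b, DifferentiableAt ℝ (φ b) θ) (a : A) :
    HasFDerivAt (softmaxWeight φ a) (softmaxWeight φ a θ • softmaxScore φ a θ) θ := by
  simpa only [Real.exp_log (softmaxWeight_pos φ a _)] using
    (hasFDerivAt_log_softmaxWeight hφ a).exp

lemma norm_softmaxScore_le {φ : A → E → ℝ} {θ : E} {ℓ : ℝ}
    (hℓ : ∀ b, ‖fderiv ℝ (φ b) θ‖ ≤ ℓ) (a : A) : ‖softmaxScore φ a θ‖ ≤ 2 * ℓ :=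
  calc ‖softmaxScore φ a θ‖ ≤ ℓ + ℓ :=
        norm_sub_le_of_le (hℓ a) (norm_sum_softmaxWeight_smul_le φ θ hℓ)
    _ = 2 * ℓ := by ring

lemma norm_softmaxScore_sub_le {φ : A → E → ℝ} (hφ : ∀ b, ContDiff ℝ 2 (φ b)) {ℓ L : ℝ}
    (hℓ : ∀ b θ, ‖fderiv ℝ (φ b) θ‖ ≤ ℓ) (hL : ∀ b θ, ‖iteratedFDeriv ℝ 2 (φ b) θ‖ ≤ L)
    (a : A) (θ₁ θ₂ : E) :
    ‖softmaxScore φ a θ₁ - softmaxScore φ a θ₂‖ ≤ 2 * (ℓ ^ 2 + L) * ‖θ₁ - θ₂‖ := by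
  have hd (θ : E) (b : A) : DifferentiableAt ℝ (φ b) θ := (hφ b).differentiable (by norm_num) θ
  have hd₂ (θ : E) (b : A) :
      HasFDerivAt (fderiv ℝ (φ b)) (fderiv ℝ (fderiv ℝ (φ b)) θ) θ :=
    (((hφ b).fderiv_right (m := 1) (by norm_num)).differentiable (by norm_num) θ).hasFDerivAt
  have hL' (θ : E) (b : A) : ‖fderiv ℝ (fderiv ℝ (φ b)) θ‖ ≤ L := by
    rw [← norm_iteratedFDeriv_one, norm_iteratedFDeriv_fderiv]
    exact hL b θ
  have hderiv (θ : E) : HasFDerivAt (softmaxScore φ a) (fderiv ℝ (fderiv ℝ (φ a)) θ -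
      ∑ b, softmaxWeight φ b θ • (fderiv ℝ (fderiv ℝ (φ b)) θ +
        (softmaxScore φ b θ).smulRight (fderiv ℝ (φ b) θ))) θ := by
    have hsum := HasFDerivAt.fun_sum (u := (Finset.univ : Finset A)) fun b _ =>
      (hasFDerivAt_softmaxWeight (hd θ) b).fun_smul (hd₂ θ b)
    refine ((hd₂ θ a).fun_sub hsum).congr_fderiv ?_
    congr 1
    refine Finset.sum_congr rfl fun b _ => ?_
    ext v w
    simp [mul_assoc]
  refine Convex.norm_image_sub_le_of_norm_hasFDerivWithin_le
    (fun θ _ => (hderiv θ).hasFDerivWithinAt) (fun θ _ => ?_) convex_univ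
    (Set.mem_univ θ₂) (Set.mem_univ θ₁)
  calc _ ≤ L + (L + 2 * ℓ * ℓ) := by
        refine norm_sub_le_of_le (hL' θ a) (norm_sum_softmaxWeight_smul_le φ θ fun b => ?_)
        refine norm_add_le_of_le (hL' θ b) ?_
        rw [ContinuousLinearMap.norm_smulRight_apply]
        have hs := norm_softmaxScore_le (fun b => hℓ b θ) b
        exact mul_le_mul hs (hℓ b θ) (norm_nonneg _) ((norm_nonneg _).trans hs)
    _ = 2 * (ℓ ^ 2 + L) := by ring

lemma norm_gradient_log_softmaxWeight_sub_le {V : Type*} [NormedAddCommGroup V]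
    [InnerProductSpace ℝ V] [CompleteSpace V] {φ : A → V → ℝ}
    (hφ : ∀ b, ContDiff ℝ 2 (φ b)) {ℓ L : ℝ} (hℓ : ∀ b θ, ‖gradient (φ b) θ‖ ≤ ℓ)
    (hL : ∀ b θ, ‖iteratedFDeriv ℝ 2 (φ b) θ‖ ≤ L) (a : A) (θ₁ θ₂ : V) :
    ‖gradient (fun θ => Real.log (softmaxWeight φ a θ)) θ₁ -
      gradient (fun θ => Real.log (softmaxWeight φ a θ)) θ₂‖ ≤
      2 * (ℓ ^ 2 + L) * ‖θ₁ - θ₂‖ := by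
  have hd (θ : V) (b : A) : DifferentiableAt ℝ (φ b) θ := (hφ b).differentiable (by norm_num) θ
  simp only [gradient, LinearIsometryEquiv.norm_map] at hℓ
  rw [gradient, gradient, ← map_sub, LinearIsometryEquiv.norm_map,
    (hasFDerivAt_log_softmaxWeight (hd θ₁) a).fderiv,
    (hasFDerivAt_log_softmaxWeight (hd θ₂) a).fderiv]
  exact norm_softmaxScore_sub_le hφ hℓ hL a θ₁ θ₂

end Softmax

lemma sum_pow_mul_succ_le {γ : ℝ} (h0 : 0 ≤ γ) (h1 : γ < 1) (H : ℕ) :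
    ∑ t : Fin H, γ ^ (t : ℕ) * ((t : ℕ) + 1 : ℝ) ≤ 1 / (1 - γ) ^ 2 := by
  rw [Fin.sum_univ_eq_sum_range (fun t : ℕ => γ ^ t * ((t : ℝ) + 1))]
  have h := hasSum_choose_mul_geometric_of_norm_lt_one 1
    (show ‖γ‖ < 1 by rwa [Real.norm_of_nonneg h0])
  simp only [Nat.choose_one_right, Nat.cast_add, Nat.cast_one, mul_comm _ (γ ^ _)] at h
  exact sum_le_hasSum _ (fun t _ => by positivity) h

/-- Lipschitz continuity of the REINFORCE estimator in the parameter: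
`‖ĝ(τ|θ₁,r) − ĝ(τ|θ₂,r)‖ ≤ (2(ℓψ² + Lψ)/(1−γ)²) · (max_{(s,a)} |r(s,a)|) · ‖θ₁ − θ₂‖`. -/
theorem reinforceEst_lipschitz_param {S A : Type*} [Fintype S] [Fintype A]
    [Nonempty S] [Nonempty A] {d : ℕ}
    (ψ : S → A → EuclideanSpace ℝ (Fin d) → ℝ)
    (ℓψ Lψ : ℝ) (hℓ : 0 ≤ ℓψ) (hL : 0 ≤ Lψ)
    (hsmooth : ∀ s a, ContDiff ℝ 2 (ψ s a))
    (hbound : ∀ s a θ, ‖gradient (ψ s a) θ‖ ≤ ℓψ)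
    (hhess : ∀ s a θ, ‖iteratedFDeriv ℝ 2 (ψ s a) θ‖ ≤ Lψ)
    (γ : ℝ) (hγ0 : 0 < γ) (hγ1 : γ < 1)
    {H : ℕ} (hH : 1 ≤ H) (τ : Fin H → S × A)
    (θ₁ θ₂ : EuclideanSpace ℝ (Fin d)) (r : S × A → ℝ) :
    ‖reinforceEst ψ γ τ θ₁ r - reinforceEst ψ γ τ θ₂ r‖ ≤
      2 * (ℓψ ^ 2 + Lψ) / (1 - γ) ^ 2 *
        (Finset.univ.sup' Finset.univ_nonempty (fun p : S × A => |r p|)) *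
        ‖θ₁ - θ₂‖ := by
  set R := Finset.univ.sup' Finset.univ_nonempty (fun p : S × A => |r p|)
  have hr (p : S × A) : |r p| ≤ R := Finset.le_sup' (fun p => |r p|) (Finset.mem_univ p)
  have hR : 0 ≤ R := (abs_nonneg _).trans (hr (Classical.arbitrary _))
  set K := 2 * (ℓψ ^ 2 + Lψ) * ‖θ₁ - θ₂‖ with hK
  have hK0 : 0 ≤ K := by positivity
  have hscore (s : S) (a : A) :
      ‖gradient (fun θ => Real.log (softmaxPolicy ψ θ s a)) θ₁ -
        gradient (fun θ => Real.log (softmaxPolicy ψ θ s a)) θ₂‖ ≤ K :=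
    norm_gradient_log_softmaxWeight_sub_le (hsmooth s) (hbound s) (hhess s) a θ₁ θ₂
  simp only [reinforceEst]
  rw [← Finset.sum_sub_distrib]
  calc _ ≤ ∑ t : Fin H, γ ^ (t : ℕ) * ((t : ℕ) + 1 : ℝ) * (R * K) := by
        refine norm_sum_le_of_le _ fun t _ => ?_
        have hinner := norm_sum_le_of_le (Finset.Iic t) fun t' _ => hscore (τ t').1 (τ t').2
        rw [Finset.sum_const, Fin.card_Iic, nsmul_eq_mul, Finset.sum_sub_distrib] at hinner
        push_cast at hinner
        rw [← smul_sub, norm_smul, norm_mul, Real.norm_of_nonneg (pow_nonneg hγ0.le _),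
          Real.norm_eq_abs]
        calc _ ≤ γ ^ (t : ℕ) * R * (((t : ℕ) + 1 : ℝ) * K) := by
              gcongr
              exact hr _
          _ = _ := by ring
    _ ≤ 1 / (1 - γ) ^ 2 * (R * K) := by
        rw [← Finset.sum_mul]
        gcongr
        exact sum_pow_mul_succ_le hγ0.le hγ1 H
    _ = _ := by rw [hK]; ring
end

section
/- Suppose that for every (s,a) ∈ 𝒮 × 𝒜 the map θ ↦ ψ(s,a;θ) is differentiable on ℝ^d with ‖∇_θ ψ(s,a;θ)‖ ≤ ℓ_ψ for all θ, where ℓ_ψ ≥ 0, and fix γ ∈ (0,1). Then for all θ₁, θ₂ ∈ ℝ^d the unnormalized occupancy measures of the soft-max policies satisfy Σ_{(s,a)∈𝒮×𝒜} |λ(π_{θ₁})(s,a) − λ(π_{θ₂})(s,a)| ≤ (2ℓ_ψ/(1−γ)²) · ‖θ₁ − θ₂‖. -/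
open Finset

/-- The unnormalized occupancy measure `λ(π)(s,a) = Σ_{t=0}^{∞} γ^t ℙ(s_t=s,a_t=a|π,ξ)`. -/
noncomputable def occMeasure {S A : Type*} [Fintype S] [Fintype A] [DecidableEq S]
    [DecidableEq A] (ξ : S → ℝ) (P : S → A → S → ℝ) (γ : ℝ) (π : S → A → ℝ)
    (s : S) (a : A) : ℝ :=
  ∑' t : ℕ, γ ^ t * stepProb ξ P π t s a

lemma trajProb_snoc {S A : Type*} [Fintype S] [Fintype A] (ξ : S → ℝ) (P : S → A → S → ℝ)
    (π : S → A → ℝ) {t : ℕ} (τ : Fin (t + 1) → S × A) (x : S × A) :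
    trajProb ξ P π (Fin.snoc τ x : Fin (t + 2) → S × A) =
      trajProb ξ P π τ *
        (P (τ (Fin.last t)).1 (τ (Fin.last t)).2 x.1 * π x.1 x.2) := by
  have hcast (i : ℕ) (hi : i < t + 1) (hi' : i < t + 2) :
      (Fin.snoc τ x : Fin (t + 2) → S × A) ⟨i, hi'⟩ = τ ⟨i, hi⟩ :=
    Fin.snoc_castSucc (α := fun _ => S × A) x τ ⟨i, hi⟩
  unfold trajProb
  rw [Fin.prod_univ_castSucc]
  congr 1
  · refine Finset.prod_congr rfl fun i _ => ?_
    simp only [Fin.snoc_castSucc, Fin.val_castSucc]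
    rw [hcast ((i : ℕ) - 1) (lt_of_le_of_lt (Nat.pred_le _) i.isLt)]
  · simp only [Fin.snoc_last, Fin.val_last]
    rw [if_neg (Nat.succ_ne_zero t), hcast (t + 1 - 1) (by omega)]
    rfl

lemma stepProb_zero {S A : Type*} [Fintype S] [Fintype A] [DecidableEq S] [DecidableEq A]
    (ξ : S → ℝ) (P : S → A → S → ℝ) (π : S → A → ℝ) (s : S) (a : A) :
    stepProb ξ P π 0 s a = ξ s * π s a := by
  unfold stepProb
  rw [← (Equiv.funUnique (Fin 1) (S × A)).symm.sum_comp]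
  simp [trajProb]

lemma stepProb_succ {S A : Type*} [Fintype S] [Fintype A] [DecidableEq S] [DecidableEq A]
    (ξ : S → ℝ) (P : S → A → S → ℝ) (π : S → A → ℝ) (t : ℕ) (s : S) (a : A) :
    stepProb ξ P π (t + 1) s a =
      (∑ p : S × A, stepProb ξ P π t p.1 p.2 * P p.1 p.2 s) * π s a := by
  unfold stepProb
  rw [← (Fin.snocEquiv fun _ : Fin (t + 2) => S × A).sum_comp, Fintype.sum_prod_type,
    Finset.sum_comm]
  simp only [Fin.snocEquiv, Equiv.coe_fn_mk, Fin.snoc_last, trajProb_snoc,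
    Finset.sum_ite_eq', Finset.mem_univ, if_true, Finset.sum_mul, ite_mul, zero_mul]
  rw [Finset.sum_comm]
  refine Finset.sum_congr rfl fun τ _ => ?_
  simp [mul_assoc]

lemma sum_prod_mul_policy {S A : Type*} [Fintype S] [Fintype A] {π : S → A → ℝ}
    (hπ1 : ∀ s, ∑ a, π s a = 1) (w : S → ℝ) :
    ∑ p : S × A, w p.1 * π p.1 p.2 = ∑ s, w s := by
  simp [Fintype.sum_prod_type, ← Finset.mul_sum, hπ1]

lemma sum_sum_mul_kernel {S A : Type*} [Fintype S] [Fintype A] {P : S → A → S → ℝ}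
    (hP1 : ∀ s a, ∑ s', P s a s' = 1) (f : S × A → ℝ) :
    ∑ s, ∑ p : S × A, f p * P p.1 p.2 s = ∑ p, f p := by
  rw [Finset.sum_comm]
  simp [← Finset.mul_sum, hP1]

lemma stepProb_nonneg {S A : Type*} [Fintype S] [Fintype A] [DecidableEq S] [DecidableEq A]
    {ξ : S → ℝ} {P : S → A → S → ℝ} {π : S → A → ℝ} (hξ : ∀ s, 0 ≤ ξ s)
    (hP : ∀ s a s', 0 ≤ P s a s') (hπ : ∀ s a, 0 ≤ π s a) (t : ℕ) (s : S) (a : A) :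
    0 ≤ stepProb ξ P π t s a := by
  induction t generalizing s a with
  | zero => rw [stepProb_zero]; exact mul_nonneg (hξ s) (hπ s a)
  | succ t ih =>
    rw [stepProb_succ]
    exact mul_nonneg (Finset.sum_nonneg fun p _ => mul_nonneg (ih _ _) (hP _ _ _)) (hπ s a)

lemma sum_stepProb {S A : Type*} [Fintype S] [Fintype A] [DecidableEq S] [DecidableEq A]
    {ξ : S → ℝ} {P : S → A → S → ℝ} {π : S → A → ℝ} (hξ1 : ∑ s, ξ s = 1)
    (hP1 : ∀ s a, ∑ s', P s a s' = 1) (hπ1 : ∀ s, ∑ a, π s a = 1) (t : ℕ) :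
    ∑ p : S × A, stepProb ξ P π t p.1 p.2 = 1 := by
  induction t with
  | zero => simp only [stepProb_zero, sum_prod_mul_policy hπ1, hξ1]
  | succ t ih =>
    simp only [stepProb_succ]
    rw [sum_prod_mul_policy hπ1 (fun s => ∑ p : S × A, stepProb ξ P π t p.1 p.2 * P p.1 p.2 s),
      sum_sum_mul_kernel hP1 (fun p => stepProb ξ P π t p.1 p.2), ih]

lemma sum_abs_mul_policy_sub_le {S A : Type*} [Fintype S] [Fintype A] {π₁ π₂ : S → A → ℝ}
    (hπ : ∀ s a, 0 ≤ π₁ s a) (hπ1 : ∀ s, ∑ a, π₁ s a = 1) {C : ℝ}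
    (hC : ∀ s, ∑ a, |π₁ s a - π₂ s a| ≤ C) (w₁ : S → ℝ) {w₂ : S → ℝ}
    (hw : ∀ s, 0 ≤ w₂ s) (hw1 : ∑ s, w₂ s = 1) :
    ∑ p : S × A, |w₁ p.1 * π₁ p.1 p.2 - w₂ p.1 * π₂ p.1 p.2| ≤
      ∑ s, |w₁ s - w₂ s| + C := by
  calc
    _ ≤ ∑ p : S × A, (|w₁ p.1 - w₂ p.1| * π₁ p.1 p.2 +
          w₂ p.1 * |π₁ p.1 p.2 - π₂ p.1 p.2|) := by
      refine Finset.sum_le_sum fun p _ => ?_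
      rw [← abs_of_nonneg (hπ p.1 p.2), ← abs_mul, abs_of_nonneg (hπ p.1 p.2)]
      conv_rhs => rw [← abs_of_nonneg (hw p.1), ← abs_mul, abs_of_nonneg (hw p.1)]
      refine le_of_eq_of_le (congrArg _ ?_) (abs_add_le _ _)
      ring
    _ = ∑ s, |w₁ s - w₂ s| + ∑ s, w₂ s * ∑ a, |π₁ s a - π₂ s a| := by
      rw [Finset.sum_add_distrib, sum_prod_mul_policy hπ1 (fun s => |w₁ s - w₂ s|)]
      simp [Fintype.sum_prod_type, Finset.mul_sum]
    _ ≤ ∑ s, |w₁ s - w₂ s| + ∑ s, w₂ s * C := by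
      gcongr with s _
      · exact hw s
      · exact hC s
    _ = _ := by rw [← Finset.sum_mul, hw1, one_mul]

lemma sum_abs_stepProb_sub_le {S A : Type*} [Fintype S] [Fintype A] [DecidableEq S]
    [DecidableEq A] {ξ : S → ℝ} {P : S → A → S → ℝ} {π₁ π₂ : S → A → ℝ}
    (hξ : ∀ s, 0 ≤ ξ s) (hξ1 : ∑ s, ξ s = 1) (hP : ∀ s a s', 0 ≤ P s a s')
    (hP1 : ∀ s a, ∑ s', P s a s' = 1)
    (hπ₁ : ∀ s a, 0 ≤ π₁ s a) (hπ₁1 : ∀ s, ∑ a, π₁ s a = 1)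
    (hπ₂ : ∀ s a, 0 ≤ π₂ s a) (hπ₂1 : ∀ s, ∑ a, π₂ s a = 1)
    {C : ℝ} (hC : ∀ s, ∑ a, |π₁ s a - π₂ s a| ≤ C) (t : ℕ) :
    ∑ p : S × A, |stepProb ξ P π₁ t p.1 p.2 - stepProb ξ P π₂ t p.1 p.2| ≤ (t + 1) * C := by
  induction t with
  | zero =>
    simp only [stepProb_zero]
    simpa using sum_abs_mul_policy_sub_le hπ₁ hπ₁1 hC ξ hξ hξ1
  | succ t ih =>
    simp only [stepProb_succ]
    refine (sum_abs_mul_policy_sub_le hπ₁ hπ₁1 hC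
      (fun s => ∑ p : S × A, stepProb ξ P π₁ t p.1 p.2 * P p.1 p.2 s)
      (w₂ := fun s => ∑ p : S × A, stepProb ξ P π₂ t p.1 p.2 * P p.1 p.2 s)
      (fun s => Finset.sum_nonneg fun p _ =>
        mul_nonneg (stepProb_nonneg hξ hP hπ₂ _ _ _) (hP _ _ _)) ?_).trans ?_
    · rw [sum_sum_mul_kernel hP1 (fun p => stepProb ξ P π₂ t p.1 p.2)]
      exact sum_stepProb hξ1 hP1 hπ₂1 t
    · have hstep : ∑ s, |∑ p : S × A, stepProb ξ P π₁ t p.1 p.2 * P p.1 p.2 s -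
          ∑ p : S × A, stepProb ξ P π₂ t p.1 p.2 * P p.1 p.2 s| ≤
          ∑ p : S × A, |stepProb ξ P π₁ t p.1 p.2 - stepProb ξ P π₂ t p.1 p.2| := by
        rw [← sum_sum_mul_kernel hP1
          (fun p => |stepProb ξ P π₁ t p.1 p.2 - stepProb ξ P π₂ t p.1 p.2|)]
        refine Finset.sum_le_sum fun s _ => ?_
        rw [← Finset.sum_sub_distrib]
        refine (Finset.abs_sum_le_sum_abs _ _).trans (Finset.sum_le_sum fun p _ => ?_)
        rw [← sub_mul, abs_mul, abs_of_nonneg (hP _ _ _)]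
      push_cast
      linarith

lemma sum_abs_occMeasure_sub_le {S A : Type*} [Fintype S] [Fintype A] [DecidableEq S]
    [DecidableEq A] {ξ : S → ℝ} {P : S → A → S → ℝ} {π₁ π₂ : S → A → ℝ}
    (hξ : ∀ s, 0 ≤ ξ s) (hξ1 : ∑ s, ξ s = 1) (hP : ∀ s a s', 0 ≤ P s a s')
    (hP1 : ∀ s a, ∑ s', P s a s' = 1)
    (hπ₁ : ∀ s a, 0 ≤ π₁ s a) (hπ₁1 : ∀ s, ∑ a, π₁ s a = 1)
    (hπ₂ : ∀ s a, 0 ≤ π₂ s a) (hπ₂1 : ∀ s, ∑ a, π₂ s a = 1)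
    {C : ℝ} (hC : ∀ s, ∑ a, |π₁ s a - π₂ s a| ≤ C) {γ : ℝ} (hγ0 : 0 ≤ γ) (hγ1 : γ < 1) :
    ∑ p : S × A, |occMeasure ξ P γ π₁ p.1 p.2 - occMeasure ξ P γ π₂ p.1 p.2| ≤
      C / (1 - γ) ^ 2 := by
  have hsummable {π : S → A → ℝ} (hπ : ∀ s a, 0 ≤ π s a) (hπ1 : ∀ s, ∑ a, π s a = 1)
      (p : S × A) : Summable fun t => γ ^ t * stepProb ξ P π t p.1 p.2 := by
    refine Summable.of_nonneg_of_le
      (fun t => mul_nonneg (pow_nonneg hγ0 t) (stepProb_nonneg hξ hP hπ _ _ _))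
      (fun t => ?_) (summable_geometric_of_lt_one hγ0 hγ1)
    refine mul_le_of_le_one_right (pow_nonneg hγ0 t) ?_
    rw [← sum_stepProb hξ1 hP1 hπ1 t]
    exact Finset.single_le_sum (f := fun p : S × A => stepProb ξ P π t p.1 p.2)
      (fun q _ => stepProb_nonneg hξ hP hπ _ _ _) (Finset.mem_univ p)
  have hdiff (p : S × A) := (hsummable hπ₁ hπ₁1 p).sub (hsummable hπ₂ hπ₂1 p)
  have hgeom : HasSum (fun t : ℕ => γ ^ t * ((t + 1) * C)) (C / (1 - γ) ^ 2) := by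
    have h := (hasSum_choose_mul_geometric_of_norm_lt_one 1
      (by rwa [Real.norm_of_nonneg hγ0] : ‖γ‖ < 1)).mul_left C
    rw [mul_one_div] at h
    refine (funext fun t => ?_ : (fun t : ℕ => γ ^ t * ((t + 1) * C)) = _) ▸ h
    push_cast [Nat.choose_one_right]
    ring
  calc
    _ ≤ ∑ p : S × A, ∑' t, |γ ^ t * stepProb ξ P π₁ t p.1 p.2 -
          γ ^ t * stepProb ξ P π₂ t p.1 p.2| := by
      refine Finset.sum_le_sum fun p _ => ?_
      unfold occMeasure
      rw [← (hsummable hπ₁ hπ₁1 p).tsum_sub (hsummable hπ₂ hπ₂1 p)]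
      exact norm_tsum_le_tsum_norm (hdiff p).norm
    _ = ∑' t, ∑ p : S × A, |γ ^ t * stepProb ξ P π₁ t p.1 p.2 -
          γ ^ t * stepProb ξ P π₂ t p.1 p.2| :=
      (Summable.tsum_finsetSum fun p _ => (hdiff p).abs).symm
    _ ≤ ∑' t : ℕ, γ ^ t * ((t + 1) * C) := by
      refine Summable.tsum_le_tsum (fun t => ?_) (summable_sum fun p _ => (hdiff p).abs)
        hgeom.summable
      simp only [← mul_sub, abs_mul, abs_of_nonneg (pow_nonneg hγ0 t), ← Finset.mul_sum]
      exact mul_le_mul_of_nonneg_left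
        (sum_abs_stepProb_sub_le hξ hξ1 hP hP1 hπ₁ hπ₁1 hπ₂ hπ₂1 hC t) (pow_nonneg hγ0 t)
    _ = _ := hgeom.tsum_eq

/-- The soft-max map is `2`-Lipschitz from the sup norm to the `ℓ¹` norm. -/
lemma sum_abs_softmax_sub_le {A : Type*} [Fintype A] [Nonempty A] (x y : A → ℝ) {D : ℝ}
    (hD : ∀ a, |x a - y a| ≤ D) :
    ∑ a, |Real.exp (x a) / ∑ b, Real.exp (x b) - Real.exp (y a) / ∑ b, Real.exp (y b)| ≤
      2 * D := by
  set ε : A → ℝ := fun a => (SignType.sign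
    (Real.exp (x a) / ∑ b, Real.exp (x b) - Real.exp (y a) / ∑ b, Real.exp (y b)) : ℝ)
  have hε (a : A) : |ε a| ≤ 1 := by
    simp only [ε]
    cases SignType.sign
      (Real.exp (x a) / ∑ b, Real.exp (x b) - Real.exp (y a) / ∑ b, Real.exp (y b)) <;> simp
  let e : A → ℝ → ℝ := fun a r => Real.exp (y a + r * (x a - y a))
  have he (a : A) (r : ℝ) : HasDerivAt (e a) (e a r * (x a - y a)) r := by
    simpa using (((hasDerivAt_id r).mul_const (x a - y a)).const_add (y a)).exp
  let Z : ℝ → ℝ := fun r => ∑ a, e a r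
  let N : ℝ → ℝ := fun r => ∑ a, ε a * e a r
  have hZpos (r : ℝ) : 0 < Z r := Finset.sum_pos (fun a _ => Real.exp_pos _) Finset.univ_nonempty
  have hweighted (c : A → ℝ) {K : ℝ} (hc : ∀ a, |c a| ≤ K) (r : ℝ) :
      |∑ a, c a * e a r| ≤ K * Z r := by
    rw [Finset.mul_sum]
    refine (Finset.abs_sum_le_sum_abs _ _).trans (Finset.sum_le_sum fun a _ => ?_)
    rw [abs_mul, abs_of_pos (Real.exp_pos _ : 0 < e a r)]
    exact mul_le_mul_of_nonneg_right (hc a) (Real.exp_pos _).le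
  have hZ (r : ℝ) : HasDerivAt Z (∑ a, (x a - y a) * e a r) r := by
    refine HasDerivAt.fun_sum fun a _ => ?_
    simpa only [mul_comm] using he a r
  have hN (r : ℝ) : HasDerivAt N (∑ a, (ε a * (x a - y a)) * e a r) r := by
    refine HasDerivAt.fun_sum fun a _ => ?_
    exact ((he a r).const_mul (ε a)).congr_deriv (by ring)
  have hbound (r : ℝ) : ‖((∑ a, (ε a * (x a - y a)) * e a r) * Z r -
      N r * ∑ a, (x a - y a) * e a r) / Z r ^ 2‖ ≤ 2 * D := by
    have hZr := hZpos r
    rw [Real.norm_eq_abs, abs_div, abs_of_pos (pow_pos hZr 2), div_le_iff₀ (pow_pos hZr 2)]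
    have h₁ := hweighted (fun a => ε a * (x a - y a)) (K := D) (fun a => by
      rw [abs_mul]
      exact (mul_le_of_le_one_left (abs_nonneg _) (hε a)).trans (hD a)) r
    have h₂ : |N r| ≤ 1 * Z r := hweighted ε hε r
    have h₃ := hweighted (fun a => x a - y a) hD r
    refine (abs_sub _ _).trans ?_
    rw [abs_mul, abs_mul, abs_of_pos hZr]
    have h₄ := mul_le_mul_of_nonneg_right h₁ hZr.le
    have h₅ := mul_le_mul h₂ h₃ (abs_nonneg _) (by linarith)
    calc
      _ ≤ _ := add_le_add h₄ h₅
      _ = _ := by ring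
  have hmvt := norm_image_sub_le_of_norm_deriv_le_segment_01' (f := fun r => N r / Z r)
    (fun r _ => ((hN r).div (hZ r) (hZpos r).ne').hasDerivWithinAt) (fun r _ => hbound r)
  refine le_trans (le_of_eq ?_) ((le_abs_self _).trans hmvt)
  simp only [N, Z, e, one_mul, zero_mul, add_zero, add_sub_cancel, Finset.sum_div,
    ← Finset.sum_sub_distrib]
  refine Finset.sum_congr rfl fun a _ => ?_
  rw [← sign_mul_self, mul_sub]
  ring

lemma abs_sub_le_of_norm_gradient_le {E : Type*} [NormedAddCommGroup E] [InnerProductSpace ℝ E]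
    [CompleteSpace E] {f : E → ℝ} (hf : Differentiable ℝ f) {C : ℝ}
    (hC : ∀ x, ‖gradient f x‖ ≤ C) (x y : E) : |f x - f y| ≤ C * ‖x - y‖ := by
  refine convex_univ.norm_image_sub_le_of_norm_fderiv_le (fun z _ => hf z) (fun z _ => ?_)
    (Set.mem_univ y) (Set.mem_univ x)
  simpa [gradient] using hC z

/-- Lipschitz continuity of the occupancy measure in the policy
parameter: `‖λ(π_{θ₁}) − λ(π_{θ₂})‖₁ ≤ (2ℓψ/(1−γ)²)·‖θ₁ − θ₂‖` for soft-max policies whose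
parameterization has gradients bounded by `ℓψ`. -/
theorem occMeasure_l1_lipschitz {S A : Type*} [Fintype S] [Fintype A]
    [Nonempty S] [Nonempty A] [DecidableEq S] [DecidableEq A] {d : ℕ}
    (ψ : S → A → EuclideanSpace ℝ (Fin d) → ℝ)
    (ℓψ : ℝ) (hℓ : 0 ≤ ℓψ)
    (hdiff : ∀ s a, Differentiable ℝ (ψ s a))
    (hbound : ∀ s a θ, ‖gradient (ψ s a) θ‖ ≤ ℓψ)
    (γ : ℝ) (hγ0 : 0 < γ) (hγ1 : γ < 1)
    (ξ : S → ℝ) (hξ : ∀ s, 0 ≤ ξ s) (hξ1 : ∑ s, ξ s = 1)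
    (P : S → A → S → ℝ) (hP : ∀ s a s', 0 ≤ P s a s') (hP1 : ∀ s a, ∑ s', P s a s' = 1)
    (θ₁ θ₂ : EuclideanSpace ℝ (Fin d)) :
    ∑ p : S × A,
        |occMeasure ξ P γ (softmaxPolicy ψ θ₁) p.1 p.2 -
          occMeasure ξ P γ (softmaxPolicy ψ θ₂) p.1 p.2| ≤
      2 * ℓψ / (1 - γ) ^ 2 * ‖θ₁ - θ₂‖ := by
  have hZ (θ : EuclideanSpace ℝ (Fin d)) (s : S) : 0 < ∑ a, Real.exp (ψ s a θ) :=
    Finset.sum_pos (fun a _ => Real.exp_pos _) Finset.univ_nonempty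
  have hπ (θ : EuclideanSpace ℝ (Fin d)) (s : S) (a : A) : 0 ≤ softmaxPolicy ψ θ s a :=
    div_nonneg (Real.exp_pos _).le (hZ θ s).le
  have hπ1 (θ : EuclideanSpace ℝ (Fin d)) (s : S) : ∑ a, softmaxPolicy ψ θ s a = 1 := by
    simp only [softmaxPolicy]
    rw [← Finset.sum_div, div_self (hZ θ s).ne']
  have hC (s : S) : ∑ a, |softmaxPolicy ψ θ₁ s a - softmaxPolicy ψ θ₂ s a| ≤
      2 * (ℓψ * ‖θ₁ - θ₂‖) :=
    sum_abs_softmax_sub_le _ _ fun a =>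
      abs_sub_le_of_norm_gradient_le (hdiff s a) (hbound s a) θ₁ θ₂
  refine (sum_abs_occMeasure_sub_le hξ hξ1 hP hP1 (hπ θ₁) (hπ1 θ₁) (hπ θ₂) (hπ1 θ₂) hC
    hγ0.le hγ1).trans (le_of_eq ?_)
  ring
end
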